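/- Suppose κ is a singular cardinal and μ is a cardinal with cf(κ)^{+3} ≤ μ and μ < cf(κ)^{+cf(κ)}. Then (κ⁺,κ) ↠_{cf(κ)} (μ⁺,μ) fails. -/

import Mathlib

open Cardinal Ordinal

/-- Chang's Conjecture with subscript, `(κ₁,κ₀) ↠_ν (μ₁,μ₀)`: additionally the substructure
contains every ordinal below the initial ordinal of `ν`. -/
def ChangCCSub (κ₁ κ₀ μ₁ μ₀ ν : Cardinal.{0}) : Prop :=
  ∀ (L : FirstOrder.Language.{0,0}) (_ : Countable L.Symbols) (_ : L.Structure (Set.Iio κ₁.ord)),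
    ∃ B : L.Substructure (Set.Iio κ₁.ord),
      #B = Cardinal.lift.{1,0} μ₁ ∧
      #{x : Set.Iio κ₁.ord // x ∈ B ∧ x.val < κ₀.ord} = Cardinal.lift.{1,0} μ₀ ∧
      ∀ x : Set.Iio κ₁.ord, x.val < ν.ord → x ∈ B

/-- The `ν`-th iterated cardinal successor of `μ`: if `μ = ℵ_α` then `iterSucc μ ν = ℵ_{α+ν}`. -/
noncomputable def iterSucc (μ : Cardinal.{0}) (ν : Ordinal.{0}) : Cardinal.{0} :=
  Cardinal.preAleph (Cardinal.preAleph.symm μ + ν)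


def Dir (c : Cardinal.{0}) (δ : Ordinal.{0}) : Prop :=
  ∀ s : Set Ordinal.{0}, #s ≤ Cardinal.lift.{1} c → (∀ x ∈ s, x < δ) → ∃ b < δ, ∀ x ∈ s, x < b

lemma Dir.fam {c δ} (h : Dir c δ) {ι : Type 1} (hι : #ι ≤ Cardinal.lift.{1} c)
    (g : ι → Ordinal.{0}) (hg : ∀ i, g i < δ) : ∃ b < δ, ∀ i, g i < b := by
  obtain ⟨b, hb, h'⟩ := h (Set.range g) (Cardinal.mk_range_le.trans hι) (by rintro _ ⟨i, rfl⟩; exact hg i)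
  exact ⟨b, hb, fun i => h' _ ⟨i, rfl⟩⟩

lemma Dir.mono {c d δ} (h : Dir c δ) (hd : d ≤ c) : Dir d δ :=
  fun s hs => h s (hs.trans (Cardinal.lift_le.2 hd))

lemma Dir.of_regular {c τ : Cardinal.{0}} (hτ : τ.IsRegular) (hc : c < τ) : Dir c τ.ord := by
  intro s hs hx
  refine ⟨sSup ((· + 1) '' s), ?_, ?_⟩
  · apply Ordinal.sSup_add_one_lt_of_lt_cof
    · rw [← Ordinal.lift_cof, hτ.cof_ord]
      exact hs.trans_lt (Cardinal.lift_lt.2 hc)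
    · exact hx
  · intro x hxs
    have : BddAbove ((· + 1) '' s) := by
      refine ⟨τ.ord + 1, ?_⟩
      rintro _ ⟨y, hy, rfl⟩
      exact (add_le_add_left (hx y hy).le 1)
    exact (Order.lt_add_one_iff.2 le_rfl).trans_le (le_csSup this ⟨x, hxs, rfl⟩)

lemma Dir.succ {c δ} (h : Dir c δ) (hc : 1 ≤ c) {x} (hx : x < δ) : x + 1 < δ := by
  obtain ⟨b, hb, h'⟩ := h {x} (by simpa using hc) (by simpa using hx)
  exact (Order.add_one_le_of_lt (h' x rfl)).trans_lt hb

lemma mk_Iio_le {i : Ordinal.{0}} {c : Cardinal.{0}} (hi : i ≤ c.ord) :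
    #(Set.Iio i) ≤ Cardinal.lift.{1} c := by
  rw [Cardinal.mk_Iio_ordinal, Cardinal.lift_le]
  simpa using Ordinal.card_le_card hi

structure IsNorm (e : Ordinal.{0} → Ordinal.{0}) (t γ : Ordinal.{0}) : Prop where
  mono : ∀ i j, i < j → j < t → e i < e j
  cont : ∀ i < t, Order.IsSuccLimit i → ∀ x < e i, ∃ j < i, x < e j
  lt : ∀ i < t, e i < γ
  cof : ∀ x < γ, ∃ i < t, x < e i

lemma exists_norm (δ : Ordinal.{0}) (t : Cardinal.{0}) (ht : ℵ₀ ≤ t) (hdir : Dir t δ)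
    (R : Ordinal.{0} → (Ordinal.{0} → Ordinal.{0}) → Ordinal.{0} → Prop)
    (hc : ∀ j s s' y, (∀ k ≤ j, s k = s' k) → R j s y → R j s' y)
    (hR : ∀ j < t.ord, ∀ s, (∀ k ≤ j, s k < δ) → ∃ y < δ, R j s y) :
    ∃ ξ γ, γ < δ ∧ IsNorm ξ t.ord γ ∧ ∀ j < t.ord, ∃ y, R j ξ y ∧ y < ξ (j + 1) := by
  classical
  have h1 : (1 : Cardinal) ≤ t := Cardinal.one_le_aleph0.trans ht
  have hlim : Order.IsSuccLimit t.ord := Cardinal.isSuccLimit_ord ht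
  let Y : Ordinal.{0} → (Ordinal.{0} → Ordinal.{0}) → Ordinal.{0} := fun j s =>
    max (if h : ∃ y < δ, R j s y then h.choose else 0) (s j) + 1
  have hYc : ∀ j s s', (∀ k ≤ j, s k = s' k) → Y j s = Y j s' := by
    intro j s s' h
    have : R j s = R j s' := by
      ext y; exact ⟨hc j s s' y h, hc j s' s y fun k hk => (h k hk).symm⟩
    simp only [Y, this, h j le_rfl]
  let ξ : Ordinal.{0} → Ordinal.{0} := WellFoundedLT.fix (fun i (s : ∀ j, j < i → Ordinal.{0}) =>
    ⨆ j : Set.Iio i, Y j.1 (fun k => if h : k < i then s k h else 0))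
  have hξ : ∀ i, ξ i = ⨆ j : Set.Iio i, Y j.1 ξ := by
    intro i
    have : ξ i = ⨆ j : Set.Iio i, Y j.1 (fun k => if h : k < i then ξ k else 0) := by
      exact WellFoundedLT.fix_eq _ _
    rw [this]
    congr 1; ext j : 1
    apply hYc
    intro k hk
    exact dif_pos (hk.trans_lt j.2)
  have hle : ∀ j i, j < i → Y j ξ ≤ ξ i := by
    intro j i h
    rw [hξ i]
    exact Ordinal.le_iSup (fun j : Set.Iio i => Y j.1 ξ) ⟨j, h⟩
  have hlt : ∀ i, ∀ x < ξ i, ∃ j < i, x < Y j ξ := by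
    intro i x hx
    rw [hξ i, Ordinal.lt_iSup_iff] at hx
    obtain ⟨j, hj⟩ := hx
    exact ⟨j.1, j.2, hj⟩
  have hδ : ∀ i, i < t.ord → ξ i < δ := by
    intro i
    induction i using WellFoundedLT.induction with
    | ind i ih =>
    intro hi
    have hY : ∀ j : Set.Iio i, Y j.1 ξ < δ := by
      intro j
      apply hdir.succ h1
      apply max_lt _ (ih j.1 j.2 (j.2.trans hi))
      have hh := hR j.1 (j.2.trans hi) ξ (fun k hk => ih k (hk.trans_lt j.2) ((hk.trans_lt j.2).trans hi))
      rw [dif_pos hh]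
      exact hh.choose_spec.1
    obtain ⟨b, hb, h'⟩ := hdir.fam (mk_Iio_le hi.le) _ hY
    refine lt_of_le_of_lt ?_ hb
    rw [hξ]
    exact Ordinal.iSup_le fun j => (h' j).le
  have hmono : ∀ i j, i < j → ξ i < ξ j := by
    intro i j hij
    refine lt_of_lt_of_le ?_ (hle i j hij)
    exact Order.lt_add_one_iff.2 (le_max_right _ _)
  obtain ⟨b, hb, h'⟩ := hdir.fam (mk_Iio_le (le_refl t.ord)) (fun j => ξ j.1) (fun j => hδ _ j.2)
  refine ⟨ξ, ⨆ j : Set.Iio t.ord, ξ j.1, ?_, ⟨fun i j h _ => hmono i j h, ?_, ?_, ?_⟩, ?_⟩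
  · exact (Ordinal.iSup_le fun j => (h' j).le).trans_lt hb
  · intro i hi hil x hx
    obtain ⟨j, hj, hx⟩ := hlt i x hx
    exact ⟨j + 1, hil.add_one_lt hj, hx.trans_le (hle _ _ (Order.lt_add_one_iff.2 le_rfl))⟩
  · intro i hi
    exact (hmono i (i+1) (Order.lt_add_one_iff.2 le_rfl)).trans_le
      (Ordinal.le_iSup (fun j : Set.Iio t.ord => ξ j.1) ⟨i+1, hlim.add_one_lt hi⟩)
  · intro x hx
    rw [Ordinal.lt_iSup_iff] at hx
    obtain ⟨j, hj⟩ := hx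
    exact ⟨j.1, j.2, hj⟩
  · intro j hj
    have hh := hR j hj ξ (fun k hk => hδ k (hk.trans_lt hj))
    refine ⟨hh.choose, hh.choose_spec.2, ?_⟩
    refine lt_of_lt_of_le ?_ (hle j (j+1) (Order.lt_add_one_iff.2 le_rfl))
    rw [Order.lt_add_one_iff]
    refine le_trans ?_ (le_max_left _ _)
    rw [dif_pos hh]

def Cl (g : Ordinal.{0} → Ordinal.{0}) : Set Ordinal.{0} :=
  {i | Order.IsSuccLimit i ∧ ∀ j < i, g j < i}

lemma Cl_anti {g g' : Ordinal.{0} → Ordinal.{0}} {τ : Ordinal.{0}} (h : ∀ j < τ, g j ≤ g' j) {i} (hi : i ≤ τ)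
    (hg : i ∈ Cl g') : i ∈ Cl g :=
  ⟨hg.1, fun j hj => (h j (hj.trans_le hi)).trans_lt (hg.2 j hj)⟩

lemma norm_agree {e e' : Ordinal.{0} → Ordinal.{0}} {t γ : Ordinal.{0}} (he : IsNorm e t γ) (he' : IsNorm e' t γ) :
    ∃ g : Ordinal.{0} → Ordinal.{0}, (∀ j < t, g j < t) ∧ ∀ i < t, i ∈ Cl g → e i = e' i := by
  have : ∀ j, ∃ k, j < t → (k < t ∧ e j < e' k ∧ e' j < e k) := by
    intro j
    by_cases hj : j < t
    · obtain ⟨k, hk, h1⟩ := he'.cof _ (he.lt j hj)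
      obtain ⟨l, hl, h2⟩ := he.cof _ (he'.lt j hj)
      refine ⟨max k l, fun _ => ⟨max_lt hk hl, ?_, ?_⟩⟩
      · rcases (le_max_left k l).eq_or_lt with h | h
        · rwa [← h]
        · exact h1.trans (he'.mono _ _ h (max_lt hk hl))
      · rcases (le_max_right k l).eq_or_lt with h | h
        · rwa [← h]
        · exact h2.trans (he.mono _ _ h (max_lt hk hl))
    · exact ⟨0, fun h => absurd h hj⟩
  choose g hg using this
  refine ⟨g, fun j hj => (hg j hj).1, fun i hi hcl => le_antisymm ?_ ?_⟩
  · by_contra! h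
    obtain ⟨j, hj, hx⟩ := he.cont i hi hcl.1 _ h
    have := (hg j (hj.trans hi)).2.1
    exact absurd (this.trans (he'.mono _ _ (hcl.2 j hj) hi)) hx.le.not_gt
  · by_contra! h
    obtain ⟨j, hj, hx⟩ := he'.cont i hi hcl.1 _ h
    have := (hg j (hj.trans hi)).2.2
    exact absurd (this.trans (he.mono _ _ (hcl.2 j hj) hi)) hx.le.not_gt

/-- bound for all values of `g` up to `j`. -/
lemma exists_bd {τ : Cardinal.{0}} (hτ : τ.IsRegular) {g : Ordinal.{0} → Ordinal.{0}}
    (hg : ∀ j < τ.ord, g j < τ.ord) (j) (hj : j < τ.ord) :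
    ∃ b < τ.ord, j < b ∧ ∀ l ≤ j, g l < b := by
  have hlim : Order.IsSuccLimit τ.ord := Cardinal.isSuccLimit_ord hτ.aleph0_le
  have hj' := hlim.add_one_lt hj
  obtain ⟨b, hb, h⟩ := (Dir.of_regular hτ (Cardinal.lt_ord.1 hj')).fam
    (ι := Set.Iio (j+1)) (by rw [Cardinal.mk_Iio_ordinal])
    (fun l => g l.1) (fun l => hg _ (l.2.trans hj'))
  exact ⟨max b (j+1), max_lt hb hj', lt_max_of_lt_right (Order.lt_add_one_iff.2 le_rfl),
    fun l hl => lt_max_of_lt_left (h ⟨l, Order.lt_add_one_iff.2 hl⟩)⟩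

lemma Cl_unbdd {τ : Cardinal.{0}} (hτ : τ.IsRegular) (h0 : ℵ₀ < τ) {g : Ordinal.{0} → Ordinal.{0}}
    (hg : ∀ j < τ.ord, g j < τ.ord) (k₀) (hk : k₀ < τ.ord) :
    ∃ k ∈ Cl g, k₀ < k ∧ k < τ.ord := by
  have : ∀ j, ∃ b, j < τ.ord → b < τ.ord ∧ j < b ∧ ∀ l ≤ j, g l < b := by
    intro j
    by_cases hj : j < τ.ord
    · obtain ⟨b, h⟩ := exists_bd hτ hg j hj
      exact ⟨b, fun _ => h⟩
    · exact ⟨0, fun h => absurd h hj⟩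
  choose G hG using this
  have hn : Ordinal.nfp G k₀ < τ.ord :=
    Ordinal.nfp_lt_ord (by rwa [hτ.cof_ord]) (fun i hi => (hG i hi).1) hk
  have hn' : ∀ n, G^[n] k₀ < τ.ord := fun n => (Ordinal.iterate_le_nfp G k₀ n).trans_lt hn
  have hs : ∀ n, G (G^[n] k₀) ≤ Ordinal.nfp G k₀ := fun n => by
    rw [← Function.iterate_succ_apply' G]; exact Ordinal.iterate_le_nfp G k₀ _
  have hs' : ∀ n, G^[n] k₀ < Ordinal.nfp G k₀ := fun n =>
    ((hG _ (hn' n)).2.1).trans_le (hs n)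
  have hk0 : k₀ < Ordinal.nfp G k₀ := hs' 0
  refine ⟨Ordinal.nfp G k₀, ⟨?_, ?_⟩, hk0, hn⟩
  · rw [Ordinal.isSuccLimit_iff, Order.isSuccPrelimit_iff_succ_lt]
    refine ⟨(bot_le.trans_lt hk0).ne', ?_⟩
    intro b hb
    obtain ⟨n, hn⟩ := Ordinal.lt_nfp_iff.1 hb
    exact (Order.succ_le_of_lt hn).trans_lt (hs' n)
  · intro j hj
    obtain ⟨n, hn⟩ := Ordinal.lt_nfp_iff.1 hj
    exact ((hG _ (hn' n)).2.2 j hn.le).trans_le (hs n)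


def Acc' (e : Ordinal.{0} → Ordinal.{0} → Ordinal.{0}) (χ τ : Cardinal.{0})
    (g : Ordinal.{0} → Ordinal.{0}) (α : Ordinal.{0}) : Prop :=
  α < τ.ord ∧ IsNorm (e α) χ.ord α ∧ ∀ x < α, ∃ c ∈ Cl g, x < c ∧ c < α

lemma acc_unbdd {e χ τ g α} (hχ : χ.IsRegular) (h0 : ℵ₀ < χ) (h : Acc' e χ τ g α) (k₀)
    (hk : k₀ < χ.ord) : ∃ k < χ.ord, k₀ < k ∧ e α k ∈ Cl g := by
  obtain ⟨hα, he, hc⟩ := h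
  have : ∀ j, ∃ l, j < χ.ord → l < χ.ord ∧ ∃ c ∈ Cl g, e α j < c ∧ c < e α l := by
    intro j
    by_cases hj : j < χ.ord
    · obtain ⟨c, hc, h1, h2⟩ := hc _ (he.lt j hj)
      obtain ⟨l, hl, h3⟩ := he.cof c h2
      exact ⟨l, fun _ => ⟨hl, c, hc, h1, h3⟩⟩
    · exact ⟨0, fun h => absurd h hj⟩
  choose p hp using this
  obtain ⟨k, hkc, hk1, hk2⟩ := Cl_unbdd hχ h0 (fun j hj => (hp j hj).1) k₀ hk
  have key : ∀ x < e α k, ∃ c ∈ Cl g, x < c ∧ c < e α k := by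
    intro x hx
    obtain ⟨j, hj, hxj⟩ := he.cont k hk2 hkc.1 x hx
    obtain ⟨h1, c, hc, h2, h3⟩ := hp j (hj.trans hk2)
    exact ⟨c, hc, hxj.trans h2, h3.trans (he.mono _ _ (hkc.2 j hj) hk2)⟩
  refine ⟨k, hk2, hk1, ?_, ?_⟩
  · rw [Ordinal.isSuccLimit_iff, Order.isSuccPrelimit_iff_succ_lt]
    refine ⟨(bot_le.trans_lt (he.mono _ _ hk1 hk2)).ne', ?_⟩
    intro b hb
    obtain ⟨c, hc, h1, h2⟩ := key b hb
    exact (Order.succ_le_of_lt h1).trans_lt h2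
  · intro j hj
    obtain ⟨c, hc, h1, h2⟩ := key j hj
    exact (hc.2 j h1).trans h2

lemma exists_acc {χ τ : Cardinal.{0}} (hχ : ℵ₀ ≤ χ) (hτ : τ.IsRegular) (hχτ : χ < τ)
    {e : Ordinal.{0} → Ordinal.{0} → Ordinal.{0}}
    (he : ∀ α, (∃ e', IsNorm e' χ.ord α) → IsNorm (e α) χ.ord α)
    {g : Ordinal.{0} → Ordinal.{0}} (hg : ∀ j < τ.ord, g j < τ.ord) : ∃ α, Acc' e χ τ g α := by
  obtain ⟨ξ, γ, hγ, hn, hy⟩ := exists_norm τ.ord χ hχ (Dir.of_regular hτ hχτ)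
    (fun j s y => y ∈ Cl g ∧ s j < y)
    (by
      intro j s s' y h hR
      rw [← h j le_rfl]; exact hR)
    (by
      intro j hj s hs
      obtain ⟨k, h1, h2, h3⟩ := Cl_unbdd hτ (hχ.trans_lt hχτ) hg (s j) (hs j le_rfl)
      exact ⟨k, h3, h1, h2⟩)
  refine ⟨γ, hγ, he γ ⟨ξ, hn⟩, ?_⟩
  intro x hx
  obtain ⟨i, hi, hxi⟩ := hn.cof x hx
  obtain ⟨y, ⟨h1, h2⟩, h3⟩ := hy i hi
  exact ⟨y, h1, hxi.trans h2, h3.trans (hn.lt _ ((Cardinal.isSuccLimit_ord hχ).add_one_lt hi))⟩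

lemma club_guess {χ τ : Cardinal.{0}} (hχ : χ.IsRegular) (h0 : ℵ₀ < χ) (hτ : τ.IsRegular)
    (hχτ : Order.succ χ < τ) :
    ∃ (e : Ordinal.{0} → Ordinal.{0} → Ordinal.{0}) (K : Ordinal.{0} → Set Ordinal.{0}),
      ∀ g : Ordinal.{0} → Ordinal.{0}, (∀ j < τ.ord, g j < τ.ord) → ∃ α < τ.ord,
        (∀ i j, i < j → j < χ.ord → e α i < e α j) ∧ (∀ k ∈ K α, k < χ.ord) ∧
        (∀ k < χ.ord, ∃ l ∈ K α, k < l) ∧ ∀ k ∈ K α, e α k < τ.ord ∧ e α k ∈ Cl g := by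
  classical
  have : ∀ α, ∃ e, (∃ e', IsNorm e' χ.ord α) → IsNorm e χ.ord α := by
    intro α
    by_cases h : ∃ e', IsNorm e' χ.ord α
    · exact ⟨h.choose, fun _ => h.choose_spec⟩
    · exact ⟨id, fun h' => absurd h' h⟩
  choose e he using this
  by_contra hcon
  push Not at hcon
  have step : ∀ g : Ordinal.{0} → Ordinal.{0}, ∃ g' : Ordinal.{0} → Ordinal.{0},
      (∀ j < τ.ord, g j < τ.ord) → (∀ j < τ.ord, g' j < τ.ord) ∧
      ∀ α, Acc' e χ τ g α → ∃ k < χ.ord, e α k ∈ Cl g ∧ e α k ∉ Cl g' := by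
    intro g
    obtain ⟨g', hg', h⟩ := hcon e (fun α => {k | k < χ.ord ∧ e α k ∈ Cl g})
    refine ⟨g', fun hg => ⟨hg', fun α hα => ?_⟩⟩
    obtain ⟨k, hk, h⟩ := h α hα.1 hα.2.1.mono (fun k hk => hk.1) (by
      intro k hk
      obtain ⟨l, h1, h2, h3⟩ := acc_unbdd hχ h0 hα k hk
      exact ⟨l, ⟨h1, h3⟩, h2⟩)
    exact ⟨k, hk.1, hk.2, h ((hα.2.1.lt k hk.1).trans hα.1)⟩
  choose G hG using step
  let gs : Ordinal.{0} → Ordinal.{0} → Ordinal.{0} :=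
    WellFoundedLT.fix (fun i (s : ∀ j, j < i → Ordinal.{0} → Ordinal.{0}) =>
      G (fun j => ⨆ η : Set.Iio i, s η.1 η.2 j))
  let hat : Ordinal.{0} → Ordinal.{0} → Ordinal.{0} := fun i j => ⨆ η : Set.Iio i, gs η.1 j
  have hgs : ∀ i, gs i = G (hat i) := fun i => WellFoundedLT.fix_eq _ _
  have hle : ∀ η i, η < i → ∀ j, gs η j ≤ hat i j := fun η i h j =>
    Ordinal.le_iSup (fun η : Set.Iio i => gs η.1 j) ⟨η, h⟩
  have hhm : ∀ i i', i ≤ i' → ∀ j, hat i j ≤ hat i' j := fun i i' h j =>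
    Ordinal.iSup_le fun η => hle η.1 i' (η.2.trans_le h) j
  have hgood : ∀ i, i ≤ (Order.succ χ).ord → ∀ j < τ.ord, hat i j < τ.ord := by
    intro i
    induction i using WellFoundedLT.induction with
    | ind i ih =>
    intro hi j hj
    obtain ⟨b, hb, h⟩ := (Dir.of_regular hτ hχτ).fam (mk_Iio_le hi) (fun η => gs η.1 j) (by
      intro η
      rw [hgs]
      exact (hG _ (ih η.1 η.2 (η.2.le.trans hi))).1 j hj)
    exact (Ordinal.iSup_le fun η => (h η).le).trans_lt hb
  obtain ⟨α, hα⟩ := exists_acc h0.le hτ ((Order.lt_succ χ).trans hχτ) he (hgood _ le_rfl)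
  have hk : ∀ i : Set.Iio (Order.succ χ).ord, ∃ k : Set.Iio χ.ord,
      e α k ∈ Cl (hat i) ∧ e α k ∉ Cl (gs i) := by
    intro i
    have : Acc' e χ τ (hat i.1) α := by
      refine ⟨hα.1, hα.2.1, fun x hx => ?_⟩
      obtain ⟨c, hc, h⟩ := hα.2.2 x hx
      exact ⟨c, Cl_anti (fun j _ => hhm _ _ i.2.le j) (h.2.trans hα.1).le hc, h⟩
    obtain ⟨k, h1, h2, h3⟩ := (hG _ (hgood i.1 i.2.le)).2 α this
    exact ⟨⟨k, h1⟩, h2, by rwa [hgs]⟩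
  choose k hk using hk
  have aux : ∀ a b, a < b → k a ≠ k b := by
    intro a b hab heq
    apply (hk a).2
    rw [heq]
    exact Cl_anti (fun j _ => hle a.1 b.1 hab j)
      ((hα.2.1.lt _ (k b).2).trans hα.1).le (hk b).1
  have inj : Function.Injective k := by
    intro a b hab
    rcases lt_trichotomy a b with h | h | h
    · exact absurd hab (aux a b h)
    · exact h
    · exact absurd hab.symm (aux b a h)
  have := Cardinal.mk_le_of_injective inj
  rw [Cardinal.mk_Iio_ordinal, Cardinal.mk_Iio_ordinal, Cardinal.lift_le] at this
  simp only [Cardinal.card_ord] at this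
  exact absurd this (Order.lt_succ χ).not_ge

section

noncomputable def proj (Ω : Ordinal.{0}) (S : Set Ordinal.{0}) (x : Ordinal.{0}) : Ordinal.{0} :=
  sInf (insert Ω {s | s ∈ S ∧ x ≤ s})

lemma proj_mem (Ω S x) : proj Ω S x ∈ insert Ω {s | s ∈ S ∧ x ≤ s} :=
  csInf_mem ⟨Ω, Set.mem_insert _ _⟩

lemma proj_mem' (Ω S x) : proj Ω S x ∈ insert Ω S := by
  rcases proj_mem Ω S x with h | h
  · exact Or.inl h
  · exact Or.inr h.1

lemma le_proj {Ω S x} (hx : x ≤ Ω) : x ≤ proj Ω S x := by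
  rcases proj_mem Ω S x with h | h
  · rwa [h]
  · exact h.2

lemma proj_le {Ω S x s} (hs : s ∈ S) (hx : x ≤ s) : proj Ω S x ≤ s :=
  csInf_le' (Or.inr ⟨hs, hx⟩)

lemma proj_mono {Ω S x y} (hx : x ≤ y) : proj Ω S x ≤ proj Ω S y := by
  rcases proj_mem Ω S y with h | h
  · rw [h]; exact csInf_le' (Or.inl rfl)
  · exact proj_le h.1 (hx.trans h.2)

/-- standing assumptions -/
structure Setup {A : Type 1} (F : Filter A) (θ τ : Cardinal.{0}) (f : Ordinal.{0} → A → Ordinal.{0})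
    (δ Ω : Ordinal.{0}) : Prop where
  hθ : ℵ₀ ≤ θ
  hτ : τ.IsRegular
  hθτ : Order.succ (Order.succ θ) < τ
  hA : #A ≤ Cardinal.lift.{1} θ
  hdir : Dir τ δ
  hinc : ∀ α β, α < β → β < δ → ∀ᶠ a in F, f α a < f β a
  hE : ∀ γ < δ, (∃ e, IsNorm e τ.ord γ) → ∃ e, IsNorm e τ.ord γ ∧ ∀ i < τ.ord, ∀ a, f (e i) a ≤ f γ a
  hΩ : ∀ α < δ, ∀ a, f α a ≤ Ω

def UB {A : Type 1} (F : Filter A) (f : Ordinal.{0} → A → Ordinal.{0}) (δ : Ordinal.{0})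
    (h : A → Ordinal.{0}) : Prop := ∀ α < δ, ∀ᶠ a in F, f α a ≤ h a

variable {A : Type 1} {F : Filter A} {θ τ : Cardinal.{0}} {f : Ordinal.{0} → A → Ordinal.{0}}
    {δ Ω : Ordinal.{0}}

lemma Setup.le (H : Setup F θ τ f δ Ω) {α β} (h : α ≤ β) (hβ : β < δ) : ∀ᶠ a in F, f α a ≤ f β a := by
  rcases h.eq_or_lt with rfl | h
  · exact Filter.Eventually.of_forall fun _ => le_rfl
  · exact (H.hinc _ _ h hβ).mono fun _ h => h.le

lemma bpp (H : Setup F θ τ f δ Ω) (S : A → Set Ordinal.{0}) (hS : ∀ a, #(S a) ≤ Cardinal.lift.{1} θ) :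
    ∃ ξ < δ, UB F f δ (fun a => proj Ω (S a) (f ξ a)) := by
  classical
  by_contra hcon
  push Not at hcon
  have hfail : ∀ ξ < δ, ∃ y < δ, ∃ᶠ a in F, proj Ω (S a) (f ξ a) < f y a := by
    intro ξ hξ
    have := hcon ξ hξ
    unfold UB at this
    push Not at this
    simpa using this
  have hχ : (Order.succ θ).IsRegular := Cardinal.isRegular_succ H.hθ
  obtain ⟨e, K, hK⟩ := club_guess hχ (H.hθ.trans_lt (Order.lt_succ θ)) H.hτ H.hθτ
  obtain ⟨ξ, γ, hγ, hn, hy⟩ := exists_norm δ τ H.hτ.aleph0_le H.hdir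
    (fun j s y => ∃ x, x < y ∧ y < δ ∧ (∃ᶠ a in F, proj Ω (S a) (f x a) < f y a) ∧
      ∀ α < τ.ord, (∃ η < δ, ∀ᶠ a in F, ∀ k ∈ K α, e α k ≤ j → f (s (e α k)) a ≤ f η a) →
        (∀ᶠ a in F, ∀ k ∈ K α, e α k ≤ j → f (s (e α k)) a ≤ f x a))
    (by
      rintro j s s' y h ⟨x, h1, h2, h3, h4⟩
      refine ⟨x, h1, h2, h3, fun α hα => ?_⟩
      have aux : ∀ η, (∀ᶠ a in F, ∀ k ∈ K α, e α k ≤ j → f (s (e α k)) a ≤ f η a) ↔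
         (∀ᶠ a in F, ∀ k ∈ K α, e α k ≤ j → f (s' (e α k)) a ≤ f η a) := by
        intro η
        apply Filter.eventually_congr
        refine Filter.Eventually.of_forall fun a => ?_
        refine forall_congr' fun k => forall_congr' fun _ => forall_congr' fun hk => ?_
        rw [h _ hk]
      have := h4 α hα
      simpa only [aux] using this)
    (by
      intro j hj s hs
      have : ∀ α : Set.Iio τ.ord, ∃ η < δ,
        ((∃ η < δ, ∀ᶠ a in F, ∀ k ∈ K α.1, e α.1 k ≤ j → f (s (e α.1 k)) a ≤ f η a) →
        (∀ᶠ a in F, ∀ k ∈ K α.1, e α.1 k ≤ j → f (s (e α.1 k)) a ≤ f η a)) := by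
        intro α
        by_cases h : (∃ η < δ, ∀ᶠ a in F, ∀ k ∈ K α.1, e α.1 k ≤ j → f (s (e α.1 k)) a ≤ f η a)
        · obtain ⟨η, h1, h2⟩ := h
          exact ⟨η, h1, fun _ => h2⟩
        · exact ⟨s j, hs j le_rfl, fun h' => absurd h' h⟩
      choose η h1 h2 using this
      obtain ⟨x, hx, hηx⟩ := H.hdir.fam (mk_Iio_le le_rfl) η h1
      obtain ⟨y, hyδ, hy⟩ := hfail x hx
      refine ⟨y, hyδ, x, ?_, hyδ, hy, ?_⟩
      · by_contra! hyx
        refine hy ?_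
        filter_upwards [H.le hyx hx] with a ha
        exact not_lt.2 (ha.trans (le_proj (H.hΩ x hx a)))
      · intro α hα h
        filter_upwards [h2 ⟨α, hα⟩ h, H.le (hηx ⟨α, hα⟩).le hx] with a h3 h4 k hk hkj
        exact (h3 k hk hkj).trans h4)
  obtain ⟨e', hn', he'⟩ := H.hE γ hγ ⟨ξ, hn⟩
  obtain ⟨g, hg, hag⟩ := norm_agree hn hn'
  obtain ⟨α, hα, hm, hK1, hK2, hK3⟩ := hK g hg
  have hleγ : ∀ k ∈ K α, ∀ a, f (ξ (e α k)) a ≤ f γ a := by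
    intro k hk a
    rw [hag _ (hK3 k hk).1 (hK3 k hk).2]
    exact he' _ (hK3 k hk).1 a
  have hlim : Order.IsSuccLimit τ.ord := Cardinal.isSuccLimit_ord H.hτ.aleph0_le
  have main : ∀ k : K α, ∃ (x : Ordinal.{0}) (a : A), x < δ ∧
      (∀ l ∈ K α, k.1 < l → ∃ l' ∈ K α, l' ≤ l ∧ proj Ω (S a) (f x a) < f (ξ (e α l')) a) ∧
      (∀ l ∈ K α, l ≤ k.1 → f (ξ (e α l)) a ≤ f x a) := by
    rintro ⟨k, hk⟩
    have hkτ := (hK3 k hk).1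
    obtain ⟨y, ⟨x, hxy, hyδ, hfr, hx⟩, hyξ⟩ := hy (e α k) hkτ
    have h1 := hx α hα ⟨γ, hγ, Filter.Eventually.of_forall fun a l hl _ => hleγ l hl a⟩
    have hne : {l | l ∈ K α ∧ k < l}.Nonempty := by
      obtain ⟨l, hl, hkl⟩ := hK2 k (hK1 k hk)
      exact ⟨l, hl, hkl⟩
    obtain ⟨hk'K, hkk'⟩ := csInf_mem hne
    set k' := sInf {l | l ∈ K α ∧ k < l} with hk'
    have hlt : y < ξ (e α k') := by
      have : e α k + 1 ≤ e α k' := Order.add_one_le_of_lt (hm _ _ hkk' (hK1 _ hk'K))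
      rcases this.eq_or_lt with h | h
      · rwa [← h]
      · exact hyξ.trans (hn.mono _ _ h (hK3 _ hk'K).1)
    have h2 := H.hinc y _ hlt ((hn.lt _ (hK3 _ hk'K).1).trans hγ)
    obtain ⟨a, ⟨h3, h4⟩, h5⟩ := (hfr.and_eventually h1).and_eventually h2 |>.exists
    refine ⟨x, a, hxy.trans hyδ, ?_, ?_⟩
    · intro l hl hkl
      exact ⟨k', hk'K, csInf_le' ⟨hl, hkl⟩, h3.trans h5⟩
    · intro l hl hlk
      apply h4 l hl
      rcases hlk.eq_or_lt with h | h
      · rw [h]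
      · exact (hm _ _ h (hK1 k hk)).le
  choose x a hxδ h1 h2 using main
  let Φ : K α → Σ a : A, (insert Ω (S a) : Set Ordinal.{0}) :=
    fun k => ⟨a k, ⟨proj Ω (S (a k)) (f (x k) (a k)), proj_mem' _ _ _⟩⟩
  have aux : ∀ k l : K α, k < l → Φ k ≠ Φ l := by
    intro k l hkl heq
    have ha : a k = a l := congrArg Sigma.fst heq
    have hp : proj Ω (S (a k)) (f (x k) (a k)) = proj Ω (S (a l)) (f (x l) (a l)) :=
      congrArg (fun p : (Σ a : A, (insert Ω (S a) : Set Ordinal.{0})) => p.2.1) heq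
    obtain ⟨l', hl', hll, hlt⟩ := h1 k l.1 l.2 hkl
    have h3 := h2 l l' hl' hll
    rw [hp, ha] at hlt
    exact absurd (hlt.trans_le (h3.trans (le_proj (H.hΩ _ (hxδ l) _)))) (lt_irrefl _)
  have inj : Function.Injective Φ := by
    intro k l h
    rcases lt_trichotomy k l with h' | h' | h'
    · exact absurd h (aux _ _ h')
    · exact h'
    · exact absurd h.symm (aux _ _ h')
  have hθ' : ℵ₀ ≤ Cardinal.lift.{1} θ := Cardinal.aleph0_le_lift.2 H.hθ
  have hcard : #(K α) ≤ Cardinal.lift.{1} θ := by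
    refine (Cardinal.mk_le_of_injective inj).trans ?_
    rw [Cardinal.mk_sigma]
    calc Cardinal.sum (fun a => #(insert Ω (S a) : Set Ordinal.{0}))
        ≤ Cardinal.sum (fun _ : A => Cardinal.lift.{1} θ) := by
          apply Cardinal.sum_le_sum
          intro a
          refine Cardinal.mk_insert_le.trans ?_
          exact Cardinal.add_le_of_le hθ' (hS a) (Cardinal.one_le_aleph0.trans hθ')
      _ = #A * Cardinal.lift.{1} θ := by simp
      _ ≤ Cardinal.lift.{1} θ * Cardinal.lift.{1} θ := by gcongr; exact H.hA
      _ = _ := Cardinal.mul_eq_self hθ'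
  obtain ⟨b, hb, hb'⟩ := Dir.of_regular hχ (Order.lt_succ θ) (K α) hcard hK1
  obtain ⟨l, hl, hbl⟩ := hK2 b hb
  exact absurd (hb' l hl) hbl.not_gt

lemma exists_lub (H : Setup F θ τ f δ Ω) :
    ∃ h, UB F f δ h ∧ ∀ h', UB F f δ h' → (∀ a, h' a ≤ h a) → ¬ ∃ᶠ a in F, h' a < h a := by
  classical
  by_contra hcon
  push Not at hcon
  have step : ∀ S : A → Set Ordinal.{0}, ∃ (h : A → Ordinal.{0}) (ξ : Ordinal.{0}),
      (∀ a, #(S a) ≤ Cardinal.lift.{1} θ) → ξ < δ ∧ UB F f δ h ∧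
        ∃ᶠ a in F, h a < proj Ω (S a) (f ξ a) := by
    intro S
    by_cases hS : ∀ a, #(S a) ≤ Cardinal.lift.{1} θ
    · obtain ⟨ξ, hξ, hub⟩ := bpp H S hS
      obtain ⟨h, h1, h2, h3⟩ := hcon _ hub
      exact ⟨h, ξ, fun _ => ⟨hξ, h1, h3⟩⟩
    · exact ⟨fun _ => 0, 0, fun h => absurd h hS⟩
  choose G Ξ hG using step
  let hs : Ordinal.{0} → A → Ordinal.{0} :=
    WellFoundedLT.fix (fun i (s : ∀ j, j < i → A → Ordinal.{0}) =>
      G (fun a => Set.range (fun η : Set.Iio i => s η.1 η.2 a)))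
  let S : Ordinal.{0} → A → Set Ordinal.{0} := fun i a => Set.range (fun η : Set.Iio i => hs η.1 a)
  have hhs : ∀ i, hs i = G (S i) := fun i => WellFoundedLT.fix_eq _ _
  have hScard : ∀ i < (Order.succ θ).ord, ∀ a, #(S i a) ≤ Cardinal.lift.{1} θ := by
    intro i hi a
    refine Cardinal.mk_range_le.trans ?_
    rw [Cardinal.mk_Iio_ordinal, Cardinal.lift_le]
    exact Order.lt_succ_iff.1 (Cardinal.lt_ord.1 hi)
  obtain ⟨ξ, hξ, hξ'⟩ := (H.hdir.mono ((Order.le_succ _).trans H.hθτ.le)).fam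
    (mk_Iio_le (le_refl (Order.succ θ).ord)) (fun i => Ξ (S i.1)) (fun i => (hG _ (hScard _ i.2)).1)
  have key : ∀ i : Set.Iio (Order.succ θ).ord, ∃ a, f ξ a ≤ hs i.1 a ∧
      hs i.1 a < proj Ω (S i.1 a) (f ξ a) := by
    intro i
    obtain ⟨h1, h2, h3⟩ := hG _ (hScard _ i.2)
    rw [← hhs] at h2 h3
    obtain ⟨a, ⟨h4, h5⟩, h6⟩ := ((h3.and_eventually (h2 ξ hξ)).and_eventually
      (H.le (hξ' i).le hξ)).exists
    exact ⟨a, h5, h4.trans_le (proj_mono h6)⟩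
  choose a ha1 ha2 using key
  have hcardI : #(Set.Iio (Order.succ θ).ord) = Cardinal.lift.{1} (Order.succ θ) := by
    rw [Cardinal.mk_Iio_ordinal, Cardinal.card_ord]
  have : Infinite (Set.Iio (Order.succ θ).ord) := by
    rw [Cardinal.infinite_iff, hcardI, Cardinal.aleph0_le_lift]
    exact H.hθ.trans (Order.le_succ _)
  obtain ⟨a₀, hinf⟩ := Cardinal.exists_infinite_fiber a (by
    rw [hcardI]; exact H.hA.trans_lt (Cardinal.lift_lt.2 (Order.lt_succ θ)))
  have hanti : StrictAnti (fun i : a ⁻¹' {a₀} => proj Ω (S i.1.1 a₀) (f ξ a₀)) := by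
    rintro ⟨i, hi⟩ ⟨i', hi'⟩ hlt
    simp only [Set.mem_preimage, Set.mem_singleton_iff] at hi hi'
    have h1 := ha1 i
    have h2 := ha2 i
    rw [hi] at h1 h2
    have hm : hs i.1 a₀ ∈ S i'.1 a₀ := ⟨⟨i.1, hlt⟩, rfl⟩
    exact (proj_le hm h1).trans_lt h2
  have : WellFoundedGT (a ⁻¹' {a₀}) := hanti.wellFoundedGT
  exact hinf.not_finite (Finite.of_wellFoundedLT_wellFoundedGT _)

end

section

lemma exists_fs (o : Ordinal.{0}) : ∃ c : Ordinal.{0} → Ordinal.{0},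
    (∀ i j, i ≤ j → j < o.cof.ord → c i ≤ c j) ∧ (∀ i < o.cof.ord, c i < o) ∧
    ∀ y < o, ∃ i < o.cof.ord, y ≤ c i := by
  classical
  obtain ⟨f, hf⟩ := Ordinal.exists_isFundamentalSeq (o := o) rfl
  refine ⟨fun i => if h : i < o.cof.ord then (f ⟨i, h⟩).1 else 0, ?_, ?_, ?_⟩
  · intro i j hij hj
    simp only [dif_pos hj, dif_pos (hij.trans_lt hj)]
    exact hf.strictMono.monotone (a := ⟨i, _⟩) (b := ⟨j, _⟩) hij
  · intro i hi
    simp only [dif_pos hi]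
    exact (f ⟨i, hi⟩).2
  · intro y hy
    obtain ⟨_, ⟨i, rfl⟩, hi⟩ := hf.isCofinal_range ⟨y, hy⟩
    refine ⟨i.1, i.2, ?_⟩
    have h2 : (if h : i.1 < o.cof.ord then (f ⟨i.1, h⟩).1 else 0) = (f i).1 := dif_pos i.2
    exact le_trans (show y ≤ (f i).1 from hi) h2.ge

lemma cof_le_of_cofinal {o : Ordinal.{0}} {X : Set Ordinal.{0}} (h : ∀ y < o, ∃ x ∈ X, y ≤ x ∧ x < o) :
    Cardinal.lift.{1} o.cof ≤ #X := by
  have h1 : IsCofinal {x : Set.Iio o | x.1 ∈ X} := by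
    rintro ⟨y, hy⟩
    obtain ⟨x, hx, h1, h2⟩ := h y hy
    exact ⟨⟨x, h2⟩, hx, h1⟩
  have h2 := Order.cof_le h1
  rw [Ordinal.cof_Iio, ← Ordinal.lift_cof] at h2
  refine h2.trans ?_
  refine Cardinal.mk_le_of_injective (f := fun x => (⟨x.1.1, x.2⟩ : X)) ?_
  intro a b hab
  simpa [Subtype.ext_iff] using hab

variable {A : Type 1} {F : Filter A} {θ τ : Cardinal.{0}} {f : Ordinal.{0} → A → Ordinal.{0}}
    {δ Ω : Ordinal.{0}}

lemma final (H : Setup F θ τ f δ Ω) (μ : Cardinal.{0}) (hμ : Dir μ δ) (X : Set Ordinal.{0})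
    (hXc : #X ≤ Cardinal.lift.{1} μ) (hX : ∀ α < δ, ∃ β, α ≤ β ∧ β < δ ∧ ∀ a, f β a ∈ X)
    (ν : Ordinal.{0}) (hν : μ = preAleph (preAleph.symm θ + ν))
    (hcompl : ∀ η : A → Ordinal.{0}, (∀ᶠ a in F, η a ≤ ν) → ∃ η₀, ∃ᶠ a in F, η a = η₀) : False := by
  classical
  obtain ⟨h, hub, hlub⟩ := exists_lub H
  have h1τ : 1 ≤ τ := Cardinal.one_le_aleph0.trans H.hτ.aleph0_le
  have hlt : ∀ α < δ, ∀ᶠ a in F, f α a < h a := by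
    intro α hα
    filter_upwards [H.hinc α (α+1) (Order.lt_add_one_iff.2 le_rfl) (H.hdir.succ h1τ hα),
      hub _ (H.hdir.succ h1τ hα)] with a h1 h2 using h1.trans_le h2
  choose c hc1 hc2 hc3 using fun a => exists_fs (h a)
  -- cofinalities are at most `μ`
  have hcof : ∀ᶠ a in F, (h a).cof ≤ μ := by
    have hbdd : ∀ a, BddAbove (X ∩ Set.Iio (h a)) := fun a => ⟨h a, fun x hx => hx.2.le⟩
    have h1 := hlub (fun a => sSup (X ∩ Set.Iio (h a))) (by
      intro α hα
      obtain ⟨β, hαβ, hβ, hβX⟩ := hX α hα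
      filter_upwards [H.le hαβ hβ, hlt β hβ] with a h1 h2
      exact h1.trans (le_csSup (hbdd a) ⟨hβX a, h2⟩)) (by
      intro a
      exact csSup_le' fun x hx => hx.2.le)
    rw [Filter.not_frequently] at h1
    filter_upwards [h1] with a ha
    rw [← Cardinal.lift_le.{1}]
    refine le_trans (cof_le_of_cofinal ?_) hXc
    intro y hy
    obtain ⟨x, hx, hyx⟩ := exists_lt_of_lt_csSup' (hy.trans_le (not_lt.1 ha))
    exact ⟨x, hx.1, hyx.le, hx.2⟩
  -- not frequently small
  have hbig : ∀ᶠ a in F, θ < (h a).cof := by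
    by_contra hcon
    have hfr : ∃ᶠ a in F, (h a).cof ≤ θ := by
      intro h; apply hcon; filter_upwards [h] with a ha using not_le.1 ha
    obtain ⟨ξ, hξ, hU⟩ := bpp H (fun a => if (h a).cof ≤ θ then c a '' Set.Iio (h a).cof.ord else ∅) (by
      intro a
      split_ifs with hle
      · exact Cardinal.mk_image_le.trans (mk_Iio_le (Cardinal.ord_le_ord.2 hle))
      · simp)
    refine hlub (fun a => min (h a) (proj Ω (if (h a).cof ≤ θ then c a '' Set.Iio (h a).cof.ord else ∅) (f ξ a))) ?_ (fun a => min_le_left _ _) ?_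
    · intro α hα
      filter_upwards [hub α hα, hU α hα] with a h1 h2 using le_min h1 h2
    · refine (hfr.and_eventually (hlt ξ hξ)).mono ?_
      rintro a ⟨h1, h2⟩
      obtain ⟨i, hi, hi'⟩ := hc3 a _ h2
      refine lt_of_le_of_lt (min_le_right _ _) (lt_of_le_of_lt (proj_le ?_ hi') (hc2 a i hi))
      rw [if_pos h1]
      exact ⟨i, hi, rfl⟩
  -- constant cofinality
  obtain ⟨η₀, hη⟩ := hcompl (fun a => preAleph.symm (h a).cof - preAleph.symm θ) (by
    filter_upwards [hcof] with a ha
    rw [Ordinal.sub_le]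
    have := preAleph.symm.monotone ha
    rwa [hν, OrderIso.symm_apply_apply] at this)
  set ρ := preAleph (preAleph.symm θ + η₀) with hρ
  have hY : ∃ᶠ a in F, (h a).cof = ρ ∧ θ < (h a).cof ∧ (h a).cof ≤ μ := by
    refine ((hη.and_eventually hbig).and_eventually hcof).mono ?_
    rintro a ⟨⟨h1, h2⟩, h3⟩
    refine ⟨?_, h2, h3⟩
    rw [hρ, ← h1, Ordinal.add_sub_cancel_of_le (preAleph.symm.monotone h2.le), OrderIso.apply_symm_apply]
  obtain ⟨a₀, ha₀, hθρ, hρμ⟩ := hY.exists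
  have hρreg : ρ.IsRegular := by
    rw [← ha₀]
    apply Cardinal.isRegular_cof
    rw [← Ordinal.one_lt_cof_iff]
    exact (Cardinal.one_lt_aleph0.trans_le H.hθ).trans hθρ
  rw [ha₀] at hθρ hρμ
  have hYf : ∃ᶠ a in F, (h a).cof = ρ := hY.mono fun a h => h.1
  -- each `ζ < ρ` fails
  have hfail : ∀ ζ : Set.Iio ρ.ord, ∃ ξ < δ, ¬ ∀ᶠ a in F, (h a).cof = ρ → f ξ a ≤ c a ζ.1 := by
    intro ζ
    by_contra! hcon
    refine hlub (fun a => if (h a).cof = ρ then c a ζ.1 else h a) ?_ ?_ ?_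
    · intro α hα
      filter_upwards [hcon α hα, hub α hα] with a h1 h2
      split_ifs with h3
      · exact h1 h3
      · exact h2
    · intro a
      split_ifs with h3
      · exact (hc2 a _ (by rw [h3]; exact ζ.2)).le
      · exact le_rfl
    · refine hYf.mono fun a h3 => ?_
      rw [if_pos h3]
      exact hc2 a _ (by rw [h3]; exact ζ.2)
  choose ξ hξ1 hξ2 using hfail
  obtain ⟨b, hb, hb'⟩ := hμ.fam (mk_Iio_le (Cardinal.ord_le_ord.2 hρμ)) ξ hξ1
  have : ∀ a, ∃ i < ρ.ord, (h a).cof = ρ → f b a < h a → f b a ≤ c a i := by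
    intro a
    by_cases h1 : (h a).cof = ρ ∧ f b a < h a
    · obtain ⟨i, hi, hi'⟩ := hc3 a _ h1.2
      rw [h1.1] at hi
      exact ⟨i, hi, fun _ _ => hi'⟩
    · exact ⟨0, hρreg.ord_pos, fun h2 h3 => absurd ⟨h2, h3⟩ h1⟩
  choose i hi hi' using this
  obtain ⟨ζ, hζ, hiζ⟩ := (Dir.of_regular hρreg hθρ).fam H.hA i hi
  apply hξ2 ⟨ζ, hζ⟩
  filter_upwards [H.hinc _ _ (hb' ⟨ζ, hζ⟩) hb, hlt b hb] with a h1 h2 h3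
  exact h1.le.trans ((hi' a h3 h2).trans (hc1 a _ _ (hiζ a).le (by rw [h3]; exact hζ)))

end


lemma exists_G (κ : Cardinal.{0}) (α : Ordinal.{0}) : ∃ g : Ordinal.{0} → Ordinal.{0},
    α < (Order.succ κ).ord → (∀ β < α, g β < κ.ord) ∧ Set.InjOn g (Set.Iio α) := by
  classical
  by_cases hα : α < (Order.succ κ).ord
  · have h1 : #(Set.Iio α) ≤ #(Set.Iio κ.ord) := by
      rw [Cardinal.mk_Iio_ordinal, Cardinal.mk_Iio_ordinal, Cardinal.lift_le, Cardinal.card_ord]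
      exact Order.lt_succ_iff.1 (Cardinal.lt_ord.1 hα)
    obtain ⟨φ⟩ := h1
    refine ⟨fun β => if h : β ∈ Set.Iio α then (φ ⟨β, h⟩).1 else 0, fun _ => ⟨?_, ?_⟩⟩
    · intro β hβ
      have : β ∈ Set.Iio α := hβ
      simp only [dif_pos this]
      exact (φ _).2
    · intro x hx y hy hxy
      simp only [dif_pos hx, dif_pos hy] at hxy
      have := φ.injective (Subtype.ext hxy)
      simpa using this
  · exact ⟨id, fun h => absurd h hα⟩

lemma exists_f (κ τ : Cardinal.{0}) (hκ : κ.IsSingular) (hτ : ℵ₀ ≤ τ) (hτκ : τ < κ) :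
    ∃ f : Ordinal.{0} → Set.Iio κ.ord.cof.ord → Ordinal.{0},
      (∀ α < (Order.succ κ).ord, ∀ a, f α a < κ.ord) ∧
      (∀ α β, α < β → β < (Order.succ κ).ord → ∀ᶠ a in Filter.atTop, f α a < f β a) ∧
      (∀ γ < (Order.succ κ).ord, (∃ e, IsNorm e τ.ord γ) →
        ∃ e, IsNorm e τ.ord γ ∧ ∀ i < τ.ord, ∀ a, f (e i) a ≤ f γ a) := by
  classical
  choose G hG using exists_G κ
  obtain ⟨c, hc1, hc2, hc3⟩ := exists_fs κ.ord
  have : ∀ γ, ∃ e, (∃ e', IsNorm e' τ.ord γ) → IsNorm e τ.ord γ := by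
    intro γ
    by_cases h : ∃ e', IsNorm e' τ.ord γ
    · exact ⟨h.choose, fun _ => h.choose_spec⟩
    · exact ⟨id, fun h' => absurd h' h⟩
  choose e he using this
  let T : Ordinal.{0} → Set.Iio κ.ord.cof.ord → Set Ordinal.{0} := fun α a =>
    {β | β < α ∧ (G α β < c a.1 ∨ ∃ i < τ.ord, β = e α i)}
  let Φ : ∀ α : Ordinal.{0}, (∀ β, β < α → Set.Iio κ.ord.cof.ord → Ordinal.{0}) →
      Set.Iio κ.ord.cof.ord → Ordinal.{0} := fun α s a =>
    ⨆ β : {β : Set.Iio α // β.1 ∈ T α a}, s β.1.1 β.1.2 a + 1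
  let f : Ordinal.{0} → Set.Iio κ.ord.cof.ord → Ordinal.{0} :=
    WellFoundedLT.fix (motive := fun _ => Set.Iio κ.ord.cof.ord → Ordinal.{0}) Φ
  have hf : ∀ α a, f α a = ⨆ β : {β : Set.Iio α // β.1 ∈ T α a}, (f β.1.1 a + 1) := by
    intro α a
    have h := WellFoundedLT.fix_eq (motive := fun _ => Set.Iio κ.ord.cof.ord → Ordinal.{0}) Φ α
    exact congrFun h a
  have hlt : ∀ α a, ∀ β ∈ T α a, f β a < f α a := by
    intro α a β hβ
    rw [hf α]
    refine lt_of_lt_of_le (Order.lt_add_one_iff.2 le_rfl)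
      (Ordinal.le_iSup (fun β : {β : Set.Iio α // β.1 ∈ T α a} => f β.1.1 a + 1) ⟨⟨β, hβ.1⟩, hβ⟩)
  have hlimκ : Order.IsSuccLimit κ.ord := Cardinal.isSuccLimit_ord (hτ.trans hτκ.le)
  refine ⟨f, ?_, ?_, ?_⟩
  · intro α hα a
    set ρ := max (c a.1).card τ with hρ
    have hρ0 : ℵ₀ ≤ ρ := hτ.trans (le_max_right _ _)
    have hρκ : Order.succ ρ < κ := hκ.isSuccLimit.succ_lt
      (max_lt (Cardinal.lt_ord.1 (hc2 a.1 a.2)) hτκ)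
    refine lt_trans ?_ (Cardinal.ord_lt_ord.2 hρκ)
    induction α using WellFoundedLT.induction with
    | ind α ih =>
    have hTc : #{β : Set.Iio α // β.1 ∈ T α a} ≤ Cardinal.lift.{1} ρ := by
      have hsub : #{β : Set.Iio α // β.1 ∈ T α a} ≤ #(T α a) :=
        Cardinal.mk_le_of_injective (f := fun β => (⟨β.1.1, β.2⟩ : T α a)) (by
          intro x y hxy; simpa [Subtype.ext_iff] using hxy)
      refine hsub.trans ?_
      have hsub2 : T α a ⊆ {β | β < α ∧ G α β < c a.1} ∪ e α '' Set.Iio τ.ord := by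
        rintro β ⟨h1, h2 | ⟨i, hi, rfl⟩⟩
        · exact Or.inl ⟨h1, h2⟩
        · exact Or.inr ⟨i, hi, rfl⟩
      refine (Cardinal.mk_le_mk_of_subset hsub2).trans ((Cardinal.mk_union_le _ _).trans ?_)
      refine Cardinal.add_le_of_le (Cardinal.aleph0_le_lift.2 hρ0) ?_ ?_
      · have : #{β | β < α ∧ G α β < c a.1} ≤ #(Set.Iio (c a.1)) :=
          Cardinal.mk_le_of_injective (f := fun β => (⟨G α β.1, β.2.2⟩ : Set.Iio (c a.1))) (by
            rintro ⟨x, hx⟩ ⟨y, hy⟩ hxy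
            have := (hG α hα).2 hx.1 hy.1 (congrArg Subtype.val hxy)
            simpa using this)
        refine this.trans ?_
        rw [Cardinal.mk_Iio_ordinal, Cardinal.lift_le]
        exact le_max_left _ _
      · exact Cardinal.mk_image_le.trans (mk_Iio_le (Cardinal.ord_le_ord.2 (le_max_right _ _)))
    obtain ⟨b, hb, hb'⟩ := (Dir.of_regular (Cardinal.isRegular_succ hρ0) (Order.lt_succ ρ)).fam hTc
      (fun β => f β.1.1 a) (fun β => ih β.1.1 β.1.2 (lt_trans β.1.2 hα))
    rw [hf]
    exact (Ordinal.iSup_le fun β => Order.add_one_le_of_lt (hb' β)).trans_lt hb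
  · intro α β hαβ hβ
    obtain ⟨i, hi, hi'⟩ := hc3 (G β α + 1) (hlimκ.add_one_lt ((hG β hβ).1 α hαβ))
    filter_upwards [Filter.eventually_ge_atTop (⟨i, hi⟩ : Set.Iio κ.ord.cof.ord)] with a ha
    apply hlt
    refine ⟨hαβ, Or.inl ?_⟩
    exact (Order.lt_add_one_iff.2 le_rfl).trans_le (hi'.trans (hc1 i a.1 ha a.2))
  · intro γ hγ hex
    refine ⟨e γ, he γ hex, fun i hi a => (hlt γ a _ ?_).le⟩
    exact ⟨(he γ hex).lt i hi, Or.inr ⟨i, hi, rfl⟩⟩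



lemma cc_set {κ₁ κ₀ μ₁ μ₀ ν : Cardinal.{0}} (h : ChangCCSub κ₁ κ₀ μ₁ μ₀ ν)
    (p q : Set.Iio κ₁.ord → Set.Iio κ₁.ord → Set.Iio κ₁.ord) :
    ∃ B : Set (Set.Iio κ₁.ord), (∀ x ∈ B, ∀ y ∈ B, p x y ∈ B) ∧ (∀ x ∈ B, ∀ y ∈ B, q x y ∈ B) ∧
      #B = Cardinal.lift.{1,0} μ₁ ∧
      #{x : Set.Iio κ₁.ord // x ∈ B ∧ x.val < κ₀.ord} = Cardinal.lift.{1,0} μ₀ ∧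
      ∀ x : Set.Iio κ₁.ord, x.val < ν.ord → x ∈ B := by
  let L : FirstOrder.Language.{0,0} := ⟨fun n => {_b : Bool // n = 2}, fun _ => Empty⟩
  have hc : Countable L.Symbols := by
    have h1 : ∀ n, Countable (L.Functions n) := fun n =>
      inferInstanceAs (Countable {_b : Bool // n = 2})
    have h2 : ∀ n, Countable (L.Relations n) := fun n =>
      inferInstanceAs (Countable Empty)
    unfold FirstOrder.Language.Symbols
    infer_instance
  let S : L.Structure (Set.Iio κ₁.ord) :=
    { funMap := fun {n} (b : {_b : Bool // n = 2}) x =>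
        if b.1 then p (x ⟨0, by have := b.2; omega⟩) (x ⟨1, by have := b.2; omega⟩)
          else q (x ⟨0, by have := b.2; omega⟩) (x ⟨1, by have := b.2; omega⟩)
      RelMap := fun {n} (b : Empty) _ => b.elim }
  obtain ⟨B, h1, h2, h3⟩ := h L hc S
  refine ⟨B, ?_, ?_, h1, h2, h3⟩
  · intro x hx y hy
    exact B.fun_mem (n := 2) (⟨true, rfl⟩ : {_b : Bool // 2 = 2}) ![x, y]
      (by intro i; fin_cases i <;> assumption)
  · intro x hx y hy
    exact B.fun_mem (n := 2) (⟨false, rfl⟩ : {_b : Bool // 2 = 2}) ![x, y]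
      (by intro i; fin_cases i <;> assumption)

lemma compl_aux {θ : Cardinal.{0}} (hθ : θ.IsRegular) (ν : Ordinal.{0}) (hν : ν < θ.ord)
    (η : Set.Iio θ.ord → Ordinal.{0}) (h : ∀ᶠ a in Filter.atTop, η a ≤ ν) :
    ∃ η₀, ∃ᶠ a in Filter.atTop, η a = η₀ := by
  by_contra hcon
  push Not at hcon
  have hlim := Cardinal.isSuccLimit_ord hθ.aleph0_le
  have : Nonempty (Set.Iio θ.ord) := ⟨⟨ν, hν⟩⟩
  have hcon' : ∀ η₀, ∃ b : Set.Iio θ.ord, ∀ a ≥ b, η a ≠ η₀ := fun η₀ =>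
    Filter.eventually_atTop.1 (hcon η₀)
  choose b hb using hcon'
  obtain ⟨b₀, hb₀⟩ := Filter.eventually_atTop.1 h
  have hν1 : ν + 1 < θ.ord := by
    have := hlim.succ_lt hν
    rwa [Order.succ_eq_add_one] at this
  obtain ⟨B, hB, hB'⟩ := (Dir.of_regular hθ (Cardinal.lt_ord.1 hν1)).fam (ι := Set.Iio (ν + 1))
    (by rw [Cardinal.mk_Iio_ordinal]) (fun i => (b i.1).1) (fun i => (b i.1).2)
  let m : Set.Iio θ.ord := max b₀ ⟨B, hB⟩
  have h1 := hb₀ m (le_max_left _ _)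
  refine hb (η m) m ?_ rfl
  exact le_trans (show b (η m) ≤ ⟨B, hB⟩ from (hB' ⟨η m, Order.lt_add_one_iff.2 h1⟩).le) (le_max_right _ _)

theorem cc_fails_near_cof (κ μ : Cardinal.{0})
    (hκ : ℵ₀ ≤ κ) (hsing : κ.ord.cof < κ)
    (hμ₁ : iterSucc κ.ord.cof 3 ≤ μ) (hμ₂ : μ < iterSucc κ.ord.cof κ.ord.cof.ord) :
    ¬ ChangCCSub (Order.succ κ) κ (Order.succ μ) μ κ.ord.cof := by
  classical
  intro hCC
  have hS : κ.IsSingular := ⟨hκ, hsing.ne⟩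
  have hθr : κ.ord.cof.IsRegular := Cardinal.isRegular_cof (Cardinal.isSuccLimit_ord hκ)
  obtain ⟨θ, hθdef⟩ : ∃ θ, θ = κ.ord.cof := ⟨_, rfl⟩
  obtain ⟨τ, hτdef⟩ : ∃ τ, τ = Order.succ (Order.succ (Order.succ κ.ord.cof)) := ⟨_, rfl⟩
  have hθ0 : ℵ₀ ≤ κ.ord.cof := hθr.aleph0_le
  have hτμ : τ ≤ μ := by
    refine le_trans (le_of_eq ?_) hμ₁
    have h3 : (3 : Ordinal.{0}) = 1 + 1 + 1 := by norm_num
    rw [hτdef, iterSucc, h3, ← add_assoc, ← add_assoc, preAleph_add_one, preAleph_add_one,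
      preAleph_add_one, OrderIso.apply_symm_apply]
  have hθτ : κ.ord.cof ≤ τ := by
    rw [hτdef]
    exact ((Order.le_succ _).trans (Order.le_succ _)).trans (Order.le_succ _)
  have hτκ : τ < κ := by
    rw [hτdef]
    exact hS.isSuccLimit.succ_lt (hS.isSuccLimit.succ_lt (hS.isSuccLimit.succ_lt hsing))
  have hτr : τ.IsRegular := by
    rw [hτdef]
    exact Cardinal.isRegular_succ ((hθ0.trans (Order.le_succ _)).trans (Order.le_succ _))
  have hμ0 : ℵ₀ ≤ μ := hτr.aleph0_le.trans hτμ
  obtain ⟨f, hf1, hf2, hf3⟩ := exists_f κ τ hS hτr.aleph0_le hτκ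
  choose G hG using exists_G κ
  have hκκ : κ.ord < (Order.succ κ).ord := Cardinal.ord_lt_ord.2 (Order.lt_succ κ)
  have hκpos : 0 < κ.ord := by
    rw [Cardinal.lt_ord]; simpa using lt_of_lt_of_le Cardinal.aleph0_pos hκ
  let zero : Set.Iio (Order.succ κ).ord := ⟨0, hκpos.trans hκκ⟩
  obtain ⟨B, hp, hq, hB1, hB2, hB3⟩ := cc_set hCC
    (fun x y => if h : y.1 < κ.ord.cof.ord then
      ⟨f x.1 ⟨y.1, h⟩, (hf1 x.1 x.2 _).trans hκκ⟩ else zero)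
    (fun x y => if h : y.1 < x.1 then
      ⟨G x.1 y.1, ((hG x.1 x.2).1 y.1 h).trans hκκ⟩ else zero)
  let Bs : Set Ordinal.{0} := Subtype.val '' B
  let X : Set Ordinal.{0} := {x | x ∈ Bs ∧ x < κ.ord}
  have hBs : #Bs = Cardinal.lift.{1} (Order.succ μ) := by
    rw [← hB1]; exact Cardinal.mk_image_eq Subtype.val_injective
  have hXc : #X = Cardinal.lift.{1} μ := by
    rw [← hB2]
    have : X = Subtype.val '' {x : Set.Iio (Order.succ κ).ord | x ∈ B ∧ x.val < κ.ord} := by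
      ext x; constructor
      · rintro ⟨⟨y, hy, rfl⟩, h⟩
        exact ⟨y, ⟨hy, h⟩, rfl⟩
      · rintro ⟨y, ⟨hy, h⟩, rfl⟩
        exact ⟨⟨y, hy, rfl⟩, h⟩
    rw [this]
    exact Cardinal.mk_image_eq Subtype.val_injective
  have hBlt : ∀ x ∈ Bs, x < (Order.succ κ).ord := by
    rintro _ ⟨y, _, rfl⟩; exact y.2
  have hfX : ∀ x ∈ Bs, ∀ a, f x a ∈ X := by
    rintro _ ⟨x, hx, rfl⟩ a
    have haκ : a.1 < (Order.succ κ).ord :=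
      (lt_trans a.2 (Cardinal.ord_lt_ord.2 hsing)).trans hκκ
    have h1 := hp x hx ⟨a.1, haκ⟩ (hB3 _ a.2)
    have ha : a.1 < κ.ord.cof.ord := a.2
    simp only [dif_pos ha] at h1
    exact ⟨⟨_, h1, rfl⟩, hf1 _ x.2 _⟩
  have hGX : ∀ x ∈ Bs, ∀ y ∈ Bs, y < x → G x y ∈ X := by
    rintro _ ⟨x, hx, rfl⟩ _ ⟨y, hy, rfl⟩ hyx
    have h1 := hq x hx y hy
    simp only [dif_pos hyx] at h1
    exact ⟨⟨_, h1, rfl⟩, (hG _ x.2).1 _ hyx⟩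
  have hseg : ∀ x ∈ Bs, #{y | y ∈ Bs ∧ y < x} ≤ Cardinal.lift.{1} μ := by
    intro x hx
    rw [← hXc]
    refine Cardinal.mk_le_of_injective
      (f := fun y : {y | y ∈ Bs ∧ y < x} => (⟨G x y.1, hGX x hx y.1 y.2.1 y.2.2⟩ : X)) ?_
    rintro ⟨y, hy⟩ ⟨z, hz⟩ hyz
    exact Subtype.ext ((hG x (hBlt x hx)).2 hy.2 hz.2 (congrArg Subtype.val hyz))
  have hℓ : ℵ₀ ≤ Cardinal.lift.{1} μ := Cardinal.aleph0_le_lift.2 hμ0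
  have hdirB : ∀ s : Set Ordinal.{0}, #s ≤ Cardinal.lift.{1} μ → s ⊆ Bs → ∃ b ∈ Bs, ∀ x ∈ s, x < b := by
    intro s hs hsB
    by_contra hcon
    push Not at hcon
    have hsub : Bs ⊆ ⋃ x ∈ s, ({y | y ∈ Bs ∧ y < x} ∪ {x}) := by
      intro b hb
      obtain ⟨x, hx, hbx⟩ := hcon b hb
      rw [Set.mem_iUnion₂]
      refine ⟨x, hx, ?_⟩
      rcases hbx.lt_or_eq with h | h
      · exact Or.inl ⟨hb, h⟩
      · exact Or.inr h
    have h1 := (Cardinal.mk_le_mk_of_subset hsub).trans (Cardinal.mk_biUnion_le _ s)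
    have h2 : (⨆ x : s, #({y | y ∈ Bs ∧ y < x.1} ∪ {x.1} : Set Ordinal.{0})) ≤ Cardinal.lift.{1} μ := by
      refine ciSup_le' ?_
      intro x
      refine (Cardinal.mk_union_le _ _).trans (Cardinal.add_le_of_le hℓ (hseg _ (hsB x.2)) ?_)
      rw [Cardinal.mk_singleton]
      exact Cardinal.one_le_aleph0.trans hℓ
    have h3 := h1.trans (mul_le_mul' hs h2)
    rw [Cardinal.mul_eq_self hℓ, hBs, Cardinal.lift_le] at h3
    exact absurd (Order.lt_succ μ) h3.not_gt
  have hbdd : BddAbove Bs := ⟨_, fun x hx => (hBlt x hx).le⟩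
  let δ := sSup Bs
  have hδ : ∀ x, x < δ ↔ ∃ b ∈ Bs, x < b := by
    intro x
    constructor
    · intro h
      have hne : Bs.Nonempty := by
        obtain ⟨b, hb, _⟩ := hdirB ∅ (by simp) (Set.empty_subset _)
        exact ⟨b, hb⟩
      exact exists_lt_of_lt_csSup hne h
    · rintro ⟨b, hb, h⟩
      exact h.trans_le (le_csSup hbdd hb)
  have hδκ : δ ≤ (Order.succ κ).ord := csSup_le' fun x hx => (hBlt x hx).le
  have hBδ : ∀ x ∈ Bs, x < δ := by
    intro x hx
    obtain ⟨b, hb, h⟩ := hdirB {x} (by rw [Cardinal.mk_singleton]; exact Cardinal.one_le_aleph0.trans hℓ)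
      (by simpa using hx)
    exact (hδ x).2 ⟨b, hb, h x rfl⟩
  have hDir : Dir μ δ := by
    intro s hs hlt
    have : ∀ x : s, ∃ b ∈ Bs, x.1 < b := fun x => (hδ x.1).1 (hlt x.1 x.2)
    choose g hg1 hg2 using this
    obtain ⟨b, hb, h⟩ := hdirB (Set.range g) (Cardinal.mk_range_le.trans hs)
      (by rintro _ ⟨x, rfl⟩; exact hg1 x)
    exact ⟨b, hBδ b hb, fun x hx => (hg2 ⟨x, hx⟩).trans (h _ ⟨_, rfl⟩)⟩
  have hSet : Setup (Filter.atTop : Filter (Set.Iio κ.ord.cof.ord)) κ.ord.cof τ f δ κ.ord :=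
    { hθ := hθ0
      hτ := hτr
      hθτ := by rw [hτdef]; exact Order.lt_succ _
      hA := mk_Iio_le le_rfl
      hdir := hDir.mono hτμ
      hinc := fun α β h1 h2 => hf2 α β h1 (h2.trans_le hδκ)
      hE := fun γ h1 h2 => hf3 γ (h1.trans_le hδκ) h2
      hΩ := fun α h1 a => (hf1 α (h1.trans_le hδκ) a).le }
  have hθμ : preAleph.symm κ.ord.cof ≤ preAleph.symm μ := preAleph.symm.monotone (hθτ.trans hτμ)
  refine final hSet μ hDir X hXc.le ?_ (preAleph.symm μ - preAleph.symm κ.ord.cof) ?_ ?_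
  · intro α hα
    obtain ⟨b, hb, h⟩ := (hδ α).1 hα
    exact ⟨b, h.le, hBδ b hb, hfX b hb⟩
  · rw [Ordinal.add_sub_cancel_of_le hθμ, OrderIso.apply_symm_apply]
  · refine compl_aux hθr _ ?_
    have h := hμ₂
    rw [iterSucc] at h
    have h' := preAleph.symm.strictMono h
    rw [OrderIso.symm_apply_apply, ← Ordinal.add_sub_cancel_of_le hθμ] at h'
    exact (add_lt_add_iff_left _).1 h'
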